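/- Let (G, L, k, p) be a graphic instance of capacitated k-supplier with outliers in which the capacity function L is constant on ℱ, and let S ⊆ ℱ. Suppose that (i) G is connected, (ii) d(u,u') ≥ 6 for all distinct u, u' ∈ S, (iii) every vertex of G is at distance at most 5 from S, and (iv) LP_{k,p}(G, L, S) has a feasible solution. Then the instance admits a distance-23 solution. -/

import Mathlib

open Finset

open scoped Classical

/-- A graphic instance of capacitated `k`-supplier with outliers: a finite bipartite
graph `G` with client vertices `Cs`, facility vertices `Fs` (partitioning the vertex set),
and edges only between the two parts. -/
def IsGraphicInstance {V : Type*} [Fintype V] (G : SimpleGraph V)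
    (Cs Fs : Finset V) : Prop :=
  Disjoint Cs Fs ∧ Cs ∪ Fs = Finset.univ ∧
    ∀ u v, G.Adj u v → (u ∈ Cs ∧ v ∈ Fs) ∨ (u ∈ Fs ∧ v ∈ Cs)

/-- A distance-`τ` solution `(C, F, φ)` of a graphic instance. -/
def IsSolution {V : Type*} [Fintype V] [DecidableEq V] (G : SimpleGraph V)
    (Cs Fs : Finset V) (L : V → ℕ) (k p τ : ℕ)
    (C F : Finset V) (φ : V → V) : Prop :=
  C ⊆ Cs ∧ F ⊆ Fs ∧ C.card = p ∧ F.card = k ∧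
    (∀ v ∈ C, φ v ∈ F) ∧
    (∀ u ∈ F, (C.filter (fun v => φ v = u)).card ≤ L u) ∧
    (∀ v ∈ C, G.edist v (φ v) ≤ (τ : ℕ∞))

/-- A preskeleton: a subset of facilities satisfying the separation and injection
properties with respect to some distance-1 solution. -/
def IsPreskeleton {V : Type*} [Fintype V] [DecidableEq V] (G : SimpleGraph V)
    (Cs Fs : Finset V) (L : V → ℕ) (k p : ℕ) (S : Finset V) : Prop :=
  S ⊆ Fs ∧
    (∀ u ∈ S, ∀ u' ∈ S, u ≠ u' → 6 ≤ G.edist u u') ∧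
    ∃ C F φ, IsSolution G Cs Fs L k p 1 C F φ ∧
      ∃ f : V → V, Set.InjOn f ↑S ∧ ∀ u ∈ S, f u ∈ F ∧ G.edist u (f u) ≤ 2

/-- A skeleton: a preskeleton whose witnessing distance-1 solution moreover satisfies the
covering property. -/
def IsSkeleton {V : Type*} [Fintype V] [DecidableEq V] (G : SimpleGraph V)
    (Cs Fs : Finset V) (L : V → ℕ) (k p : ℕ) (S : Finset V) : Prop :=
  S ⊆ Fs ∧
    (∀ u ∈ S, ∀ u' ∈ S, u ≠ u' → 6 ≤ G.edist u u') ∧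
    ∃ C F φ, IsSolution G Cs Fs L k p 1 C F φ ∧
      (∀ u ∈ F, ∃ s ∈ S, G.edist u s ≤ 4) ∧
      ∃ f : V → V, Set.InjOn f ↑S ∧ ∀ u ∈ S, f u ∈ F ∧ G.edist u (f u) ≤ 2


/-- The constraints of the linear program `LP_{k,p}(G, L, S)` for an explicit pair `(x, y)`. -/
def LPSat {V : Type*} [Fintype V] (G : SimpleGraph V) (Cs Fs : Finset V)
    (L : V → ℕ) (k p : ℕ) (S : Finset V) (x : V → V → ℝ) (y : V → ℝ) : Prop :=
  (∀ u, 0 ≤ y u ∧ y u ≤ 1) ∧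
    (∀ u v, 0 ≤ x u v ∧ x u v ≤ 1) ∧
    (∑ u ∈ Fs, y u = k) ∧
    (∑ u ∈ Fs, ∑ v ∈ Cs, x u v = p) ∧
    (∀ u ∈ Fs, ∀ v ∈ Cs, x u v ≤ y u) ∧
    (∀ u ∈ Fs, ∑ v ∈ Cs, x u v ≤ (L u : ℝ) * y u) ∧
    (∀ v ∈ Cs, ∑ u ∈ Fs, x u v ≤ 1) ∧
    (∀ s ∈ S, 1 ≤ ∑ u ∈ Fs.filter (fun u => G.edist u s ≤ 2), y u) ∧
    (∀ u ∈ Fs, ∀ v ∈ Cs, ¬ G.Adj v u → x u v = 0)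

/-- Feasibility of the linear program `LP_{k,p}(G, L, S)`. -/
def LPFeasible {V : Type*} [Fintype V] (G : SimpleGraph V) (Cs Fs : Finset V)
    (L : V → ℕ) (k p : ℕ) (S : Finset V) : Prop :=
  ∃ x y, LPSat G Cs Fs L k p S x y

/-- `F` is an integral rounding of the weights `w` along `R`: it is a subset of the support of `w`
of the same total mass, and every set `U` of vertices reaches enough elements of `F` along `R`
to accommodate its mass. -/
def IsIntegralTransfer {V : Type*} [Fintype V] (R : V → V → Prop) (w : V → ℝ)
    (F : Finset V) : Prop :=
  (∀ u ∈ F, 0 < w u) ∧ (F.card : ℝ) = ∑ u, w u ∧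
    ∀ U : Finset V, ∑ u ∈ U, w u ≤ ((F.filter fun v => ∃ u ∈ U, R u v).card : ℝ)

/-- The weights obtained from `w` by moving the mass of `K` and part of the unit mass of `s` onto
`⌈w(K)⌉` elements of `K`, which are then discarded. -/
noncomputable def contractWeight {V : Type*} (w : V → ℝ) (s : V) (K : Finset V) (u : V) : ℝ :=
  if u = s then ∑ a ∈ K, w a + 1 - ⌈∑ a ∈ K, w a⌉₊ else if u ∈ K then 0 else w u

lemma sum_sub_contractWeight {V : Type*} [Fintype V] {w : V → ℝ} {s : V} {K : Finset V}
    (hsK : s ∉ K) (hws : w s = 1) :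
    ∑ u, (w u - contractWeight w s K u) = ⌈∑ a ∈ K, w a⌉₊ := by
  rw [← Finset.sum_subset (Finset.subset_univ (insert s K))]
  · rw [Finset.sum_insert hsK, Finset.sum_congr rfl (g := fun a => w a)]
    · simp [contractWeight, hws]
      ring
    · intro u hu
      have : u ≠ s := fun h => hsK (h ▸ hu)
      simp [contractWeight, this, hu]
  · intro u _ hu
    simp only [Finset.mem_insert, not_or] at hu
    simp [contractWeight, hu]

lemma contractWeight_le {V : Type*} {w : V → ℝ} (hw0 : ∀ u, 0 ≤ w u) {s : V} (hws : w s = 1)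
    (K : Finset V) (u : V) : contractWeight w s K u ≤ w u := by
  unfold contractWeight
  have := Nat.le_ceil (∑ a ∈ K, w a)
  split_ifs with h1 h2
  · subst h1; linarith
  · exact hw0 u
  · exact le_rfl

lemma contractWeight_self_pos {V : Type*} {w : V → ℝ} (hw0 : ∀ u, 0 ≤ w u) (s : V)
    (K : Finset V) : 0 < contractWeight w s K s := by
  have := Nat.ceil_lt_add_one (Finset.sum_nonneg fun a (_ : a ∈ K) => hw0 a)
  simp only [contractWeight, if_true]
  linarith

lemma contractWeight_nonneg {V : Type*} {w : V → ℝ} (hw0 : ∀ u, 0 ≤ w u) (s : V)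
    (K : Finset V) (u : V) : 0 ≤ contractWeight w s K u := by
  by_cases h : u = s
  · exact h ▸ (contractWeight_self_pos hw0 s K).le
  · simp only [contractWeight, h, if_false]
    split_ifs
    · exact le_rfl
    · exact hw0 u

lemma IsIntegralTransfer.of_contractWeight {V : Type*} [Fintype V] {R : V → V → Prop}
    {w : V → ℝ} (hw0 : ∀ u, 0 ≤ w u) (hw1 : ∀ u, w u ≤ 1) {s : V} (hws : w s = 1)
    {K : Finset V} (hsK : s ∉ K) (hK : ∀ u ∈ K, 0 < w u)
    (hR : ∀ u ∈ insert s K, ∀ v ∈ K, R u v) {F : Finset V}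
    (hF : IsIntegralTransfer R (contractWeight w s K) F) :
    ∃ F', IsIntegralTransfer R w F' := by
  obtain ⟨hpos, hcard, hU⟩ := hF
  have hle := contractWeight_le hw0 hws K
  have hsum := sum_sub_contractWeight hsK hws
  have hceil : ⌈∑ a ∈ K, w a⌉₊ ≤ K.card := by
    rw [Nat.ceil_le]
    simpa using Finset.sum_le_card_nsmul K w 1 fun a _ => hw1 a
  obtain ⟨O, hOK, hO⟩ := Finset.exists_subset_card_eq hceil
  have hdisj : Disjoint F O := by
    rw [Finset.disjoint_left]
    intro u huF huO
    have h1 := hpos u huF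
    have h2 : u ≠ s := fun h => hsK (h ▸ hOK huO)
    simp [contractWeight, h2, hOK huO] at h1
  refine ⟨F ∪ O, ?_, ?_, ?_⟩
  · intro u hu
    rcases Finset.mem_union.1 hu with h | h
    · exact (hpos u h).trans_le (hle u)
    · exact hK u (hOK h)
  · rw [Finset.card_union_of_disjoint hdisj]
    rw [Finset.sum_sub_distrib] at hsum
    push_cast
    rw [hO, hcard]
    linarith
  · intro U
    have hUF := hU U
    rw [Finset.filter_union, Finset.card_union_of_disjoint
      (Finset.disjoint_filter_filter hdisj)]
    push_cast
    by_cases hUK : ∃ u ∈ U, u ∈ insert s K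
    · obtain ⟨u, huU, huK⟩ := hUK
      have h1 : O.filter (fun v => ∃ u ∈ U, R u v) = O :=
        Finset.filter_true_of_mem fun v hv => ⟨u, huU, hR u huK v (hOK hv)⟩
      have h2 : ∑ u ∈ U, (w u - contractWeight w s K u) ≤
          ∑ u, (w u - contractWeight w s K u) :=
        Finset.sum_le_sum_of_subset_of_nonneg (Finset.subset_univ U)
          fun u _ _ => sub_nonneg.2 (hle u)
      rw [hsum, Finset.sum_sub_distrib] at h2
      rw [h1, hO]
      linarith
    · push Not at hUK
      have h1 : ∑ u ∈ U, w u = ∑ u ∈ U, contractWeight w s K u := by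
        refine Finset.sum_congr rfl fun u hu => ?_
        have := hUK u hu
        simp only [Finset.mem_insert, not_or] at this
        simp [contractWeight, this]
      rw [h1]
      have : (0 : ℝ) ≤ ((O.filter fun v => ∃ u ∈ U, R u v).card : ℝ) := Nat.cast_nonneg _
      linarith

/-- Every weighting of integral total mass which is `1` on `T` and supported on `N`-neighbours of
`T` has an integral transfer along `R`. -/
def AdmitsRounding {V : Type*} [Fintype V] (N R : V → V → Prop) (T : Finset V) : Prop :=
  ∀ w : V → ℝ, (∀ u, 0 ≤ w u) → (∀ u, w u ≤ 1) → (∀ t ∈ T, w t = 1) →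
    (∀ u, u ∉ T → 0 < w u → ∃ t ∈ T, N u t) → (∃ m : ℕ, ∑ u, w u = m) →
    ∃ F, IsIntegralTransfer R w F

lemma admitsRounding_singleton {V : Type*} [Fintype V] {N R : V → V → Prop} {s : V}
    (hss : R s s) (hNR : ∀ u v, u = s ∨ N u s → N v s → R u v) :
    AdmitsRounding N R {s} := by
  rintro w hw0 hw1 hwT hN ⟨m, hm⟩
  have hws : w s = 1 := hwT s (Finset.mem_singleton_self s)
  have hmem : ∀ u, u ∈ (Finset.univ.filter fun u => u ≠ s ∧ 0 < w u) ↔ u ≠ s ∧ 0 < w u := by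
    simp
  generalize (Finset.univ.filter fun u => u ≠ s ∧ 0 < w u) = K at hmem
  have hsK : s ∉ K := fun h => ((hmem s).1 h).1 rfl
  have hNK : ∀ u ∈ K, N u s := fun u hu => by
    obtain ⟨h1, h2⟩ := (hmem u).1 hu
    simpa using hN u (by simpa using h1) h2
  have hzero : ∀ u, u ≠ s → contractWeight w s K u = 0 := by
    intro u hu
    by_cases huK : u ∈ K
    · simp [contractWeight, hu, huK]
    · have : w u = 0 := le_antisymm
        (not_lt.1 fun h => huK ((hmem u).2 ⟨hu, h⟩)) (hw0 u)
      simp [contractWeight, hu, huK, this]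
  have hpos := contractWeight_self_pos hw0 s K
  have hle := contractWeight_le hw0 hws K s
  have hone : contractWeight w s K s = 1 := by
    have h := sum_sub_contractWeight hsK hws
    rw [Finset.sum_sub_distrib, hm,
      Finset.sum_eq_single s (fun u _ hu => hzero u hu) (by simp)] at h
    have h1 : (⌈∑ a ∈ K, w a⌉₊ : ℝ) < m := by linarith
    have h2 : (⌈∑ a ∈ K, w a⌉₊ : ℝ) + 1 ≤ m := by
      have : ⌈∑ a ∈ K, w a⌉₊ + 1 ≤ m := by exact_mod_cast h1
      exact_mod_cast this
    linarith
  refine IsIntegralTransfer.of_contractWeight hw0 hw1 hws hsK (fun u hu => ((hmem u).1 hu).2)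
    ?_ (F := {s}) ⟨?_, ?_, ?_⟩
  · intro u hu v hv
    exact hNR u v ((Finset.mem_insert.1 hu).imp id (hNK u)) (hNK v hv)
  · simpa using hpos
  · rw [Finset.sum_eq_single s (fun u _ hu => hzero u hu) (by simp), hone]
    simp
  · intro U
    by_cases hsU : s ∈ U
    · rw [Finset.sum_eq_single_of_mem s hsU (fun u _ hu => hzero u hu), hone,
        Finset.filter_true_of_mem]
      · simp
      · simpa using ⟨s, hsU, hss⟩
    · rw [Finset.sum_eq_zero fun u hu => hzero u fun h => hsU (h ▸ hu)]
      exact Nat.cast_nonneg _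

lemma AdmitsRounding.insert_of_linked {V : Type*} [Fintype V] {N R : V → V → Prop} {T : Finset V}
    (hT : AdmitsRounding N R T) {s t : V} (ht : t ∈ T) (hst : N s t) (hsT : s ∉ T)
    (hNR : ∀ u v, u = s ∨ N u s → N v s → R u v) :
    AdmitsRounding N R (insert s T) := by
  rintro w hw0 hw1 hwT hN ⟨m, hm⟩
  have hws : w s = 1 := hwT s (Finset.mem_insert_self s T)
  have hmem : ∀ u, u ∈ (Finset.univ.filter fun u => u ∉ insert s T ∧ 0 < w u ∧ N u s) ↔
      u ∉ insert s T ∧ 0 < w u ∧ N u s := by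
    simp
  generalize (Finset.univ.filter fun u => u ∉ insert s T ∧ 0 < w u ∧ N u s) = K at hmem
  have hsK : s ∉ K := fun h => ((hmem s).1 h).1 (Finset.mem_insert_self s T)
  have hle := contractWeight_le hw0 hws K
  have hnonneg := contractWeight_nonneg hw0 s K
  obtain ⟨F, hF⟩ := hT (contractWeight w s K) hnonneg (fun u => (hle u).trans (hw1 u))
    (by
      intro a ha
      have h1 : a ≠ s := fun h => hsT (h ▸ ha)
      have h2 : a ∉ K := fun h => ((hmem a).1 h).1 (Finset.mem_insert_of_mem ha)
      simp [contractWeight, h1, h2, hwT a (Finset.mem_insert_of_mem ha)])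
    (by
      intro u huT hu
      by_cases hus : u = s
      · exact ⟨t, ht, hus ▸ hst⟩
      have huK : u ∉ K := fun h => by simp [contractWeight, hus, h] at hu
      have huI : u ∉ insert s T := by simp [hus, huT]
      have hwu : 0 < w u := hu.trans_le (hle u)
      obtain ⟨a, ha, hua⟩ := hN u huI hwu
      rcases Finset.mem_insert.1 ha with rfl | ha
      · exact absurd ((hmem u).2 ⟨huI, hwu, hua⟩) huK
      · exact ⟨a, ha, hua⟩)
    (by
      have h := sum_sub_contractWeight hsK hws
      rw [Finset.sum_sub_distrib, hm] at h
      have h0 := Finset.sum_nonneg fun u (_ : u ∈ Finset.univ) => hnonneg u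
      have h1 : ⌈∑ a ∈ K, w a⌉₊ ≤ m := by
        have : (⌈∑ a ∈ K, w a⌉₊ : ℝ) ≤ m := by linarith
        exact_mod_cast this
      refine ⟨m - ⌈∑ a ∈ K, w a⌉₊, ?_⟩
      rw [Nat.cast_sub h1]
      linarith)
  exact IsIntegralTransfer.of_contractWeight hw0 hw1 hws hsK (fun u hu => ((hmem u).1 hu).2.1)
    (fun u hu v hv => hNR u v ((Finset.mem_insert.1 hu).imp id fun h => ((hmem u).1 h).2.2)
      ((hmem v).1 hv).2.2) hF

lemma admitsRounding_of_linked {V : Type*} [Fintype V] {N R : V → V → Prop} {S : Finset V}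
    (hS : S.Nonempty) (hR : ∀ s, R s s) (hNR : ∀ s u v, u = s ∨ N u s → N v s → R u v)
    (hlink : ∀ T ⊆ S, T.Nonempty → T ≠ S → ∃ t ∈ T, ∃ s ∈ S, s ∉ T ∧ N s t) :
    AdmitsRounding N R S := by
  have key : ∀ n, n + 1 ≤ S.card → ∃ T ⊆ S, T.card = n + 1 ∧ AdmitsRounding N R T := by
    intro n
    induction n with
    | zero =>
      intro _
      obtain ⟨s, hs⟩ := hS
      exact ⟨{s}, by simpa using hs, by simp, admitsRounding_singleton (hR s) (hNR s)⟩
    | succ n ih =>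
      intro hn
      obtain ⟨T, hTS, hTn, hT⟩ := ih (by omega)
      obtain ⟨t, ht, s, hs, hsT, hst⟩ := hlink T hTS (Finset.card_pos.1 (by omega))
        (by rintro rfl; omega)
      exact ⟨insert s T, Finset.insert_subset hs hTS,
        by rw [Finset.card_insert_of_notMem hsT, hTn], hT.insert_of_linked ht hst hsT (hNR s)⟩
  have hpos := Finset.card_pos.2 hS
  obtain ⟨T, hTS, hTn, hT⟩ := key (S.card - 1) (by omega)
  rwa [Finset.eq_of_subset_of_card_le hTS (by omega)] at hT

/-- A form of Hall's theorem for assigning `p` of the elements of `Cs` to elements of `F`, each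
of capacity `c`, along a relation `r`. -/
lemma exists_capacitated_assignment {V : Type*} [DecidableEq V] (Cs F : Finset V)
    (r : V → V → Prop) (c p : ℕ)
    (h : ∀ A ⊆ Cs, p + A.card ≤
      c * (F.filter fun u => ∃ v ∈ A, r v u).card + Cs.card) :
    ∃ C ⊆ Cs, C.card = p ∧ ∃ φ : V → V, (∀ v ∈ C, φ v ∈ F ∧ r v (φ v)) ∧
      ∀ u, (C.filter fun v => φ v = u).card ≤ c := by
  have hp : p ≤ Cs.card := by simpa using h ∅ (Finset.empty_subset _)
  set t : Cs → Finset ((V × Fin c) ⊕ Fin (Cs.card - p)) := fun v =>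
    ((F.filter fun u => r v u) ×ˢ Finset.univ).disjSum Finset.univ with ht
  obtain ⟨f, hf, hft⟩ := (Finset.all_card_le_biUnion_card_iff_exists_injective t).1 (by
    intro A
    rcases A.eq_empty_or_nonempty with rfl | ⟨a, ha⟩
    · simp
    have hsub : ((F.filter fun u => ∃ v ∈ A.map (Function.Embedding.subtype _), r v u) ×ˢ
        (Finset.univ : Finset (Fin c))).disjSum Finset.univ ⊆ A.biUnion t := by
      intro z hz
      rw [Finset.mem_biUnion]
      rcases z with ⟨u, i⟩ | j
      · simp only [Finset.inl_mem_disjSum, Finset.mem_product, Finset.mem_filter,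
          Finset.mem_univ, and_true, Finset.mem_map] at hz
        obtain ⟨huF, v, ⟨a, ha, rfl⟩, hr⟩ := hz
        exact ⟨a, ha, by simpa [ht] using ⟨huF, hr⟩⟩
      · exact ⟨a, ha, by simp [ht]⟩
    have hA := h (A.map (Function.Embedding.subtype _)) (by
      intro v hv
      simp only [Finset.mem_map] at hv
      obtain ⟨a, _, rfl⟩ := hv
      exact a.2)
    rw [Finset.card_map] at hA
    refine le_trans ?_ (Finset.card_le_card hsub)
    rw [Finset.card_disjSum, Finset.card_product, Finset.card_univ, Finset.card_univ,
      Fintype.card_fin, Fintype.card_fin, mul_comm]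
    omega)
  set D : Finset Cs := Finset.univ.filter fun v => (f v).isLeft with hD
  have hDcard : p ≤ D.card := by
    have h1 : (Finset.univ.filter fun v : Cs => ¬ (f v).isLeft = true).card ≤ Cs.card - p := by
      refine (Finset.card_le_card_of_injOn f (t := (Finset.univ :
        Finset (Fin (Cs.card - p))).map Function.Embedding.inr) ?_ hf.injOn).trans (by simp)
      intro v hv
      simp only [Finset.coe_filter, Finset.mem_univ, true_and, Set.mem_ofPred_eq] at hv
      cases hfv : f v with
      | inl z => simp [hfv] at hv
      | inr j => simp
    have h2 := Finset.card_filter_add_card_filter_not (s := (Finset.univ : Finset Cs))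
      (fun v => (f v).isLeft = true)
    rw [Finset.card_univ, Fintype.card_coe] at h2
    rw [hD]
    omega
  obtain ⟨E, hED, hE⟩ := Finset.exists_subset_card_eq hDcard
  have hφ : ∀ v : V, ∃ u : V, ∀ hv : v ∈ Cs, ∀ z, f ⟨v, hv⟩ = Sum.inl z → z.1 = u := by
    intro v
    by_cases hv : v ∈ Cs
    · cases hfv : f ⟨v, hv⟩ with
      | inl z => exact ⟨z.1, fun _ z' hz' => by rw [hfv] at hz'; simp_all⟩
      | inr j => exact ⟨v, fun _ z' hz' => by rw [hfv] at hz'; simp at hz'⟩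
    · exact ⟨v, fun hv' => absurd hv' hv⟩
  choose φ hφ using hφ
  have hEl : ∀ v ∈ E, ∃ i, f v = Sum.inl (φ v, i) := by
    intro v hv
    have h1 := hED hv
    rw [hD, Finset.mem_filter] at h1
    obtain ⟨⟨u, i⟩, hz⟩ := Sum.isLeft_iff.1 h1.2
    have h2 := hφ v v.2 _ hz
    exact ⟨i, by rw [hz, ← h2]⟩
  refine ⟨E.map (Function.Embedding.subtype _), ?_, by rw [Finset.card_map, hE], φ, ?_, ?_⟩
  · intro v hv
    simp only [Finset.mem_map] at hv
    obtain ⟨a, _, rfl⟩ := hv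
    exact a.2
  · intro v hv
    simp only [Finset.mem_map] at hv
    obtain ⟨a, ha, rfl⟩ := hv
    obtain ⟨i, hi⟩ := hEl a ha
    have h1 := hft a
    rw [hi] at h1
    simpa [ht] using h1
  · intro u
    rw [Finset.filter_map, Finset.card_map]
    refine (Finset.card_le_card_of_injOn f (t := (Finset.univ : Finset (Fin c)).image
      fun i => Sum.inl (u, i)) ?_ hf.injOn).trans (Finset.card_image_le.trans (by simp))
    intro v hv
    simp only [Finset.coe_filter, Set.mem_ofPred_eq] at hv
    obtain ⟨hvE, hvu⟩ := hv
    obtain ⟨i, hi⟩ := hEl v hvE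
    have hvu' : φ v = u := hvu
    rw [hi, hvu']
    simp

/-- Every element of `S` can be given unit weight by moving mass from the pairwise disjoint
sets `P s` onto the elements `s` of `S`. -/
lemma exists_concentrated_weight {V : Type*} [Fintype V] [DecidableEq V] (S : Finset V)
    (P : V → Finset V) (y : V → ℝ) (hy0 : ∀ u, 0 ≤ y u) (hy1 : ∀ u, y u ≤ 1)
    (hPS : ∀ s ∈ S, Disjoint (P s) S)
    (hPP : ∀ s ∈ S, ∀ t ∈ S, s ≠ t → Disjoint (P s) (P t))
    (hy : ∀ s ∈ S, 1 ≤ y s + ∑ u ∈ P s, y u) :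
    ∃ w : V → ℝ, (∀ u, 0 ≤ w u) ∧ (∀ u, w u ≤ 1) ∧ (∀ s ∈ S, w s = 1) ∧
      (∀ u, u ∉ S → w u ≤ y u) ∧ ∑ u, w u = ∑ u, y u ∧
      ∀ U : Finset V, ∑ u ∈ U, y u ≤
        ∑ u ∈ U ∪ S.filter (fun s => ∃ a ∈ U, a ∈ P s), w u := by
  have hθ : ∀ s, ∃ θ : ℝ, 0 ≤ θ ∧ θ ≤ 1 ∧ (s ∈ S → θ * ∑ u ∈ P s, y u = 1 - y s) := by
    intro s
    by_cases hs : s ∈ S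
    · have h1 := hy s hs
      have h2 := hy1 s
      have h3 : 0 ≤ ∑ u ∈ P s, y u := Finset.sum_nonneg fun u _ => hy0 u
      refine ⟨(1 - y s) / ∑ u ∈ P s, y u, by apply div_nonneg <;> linarith,
        div_le_one_of_le₀ (by linarith) h3, fun _ => div_mul_cancel_of_imp fun h => ?_⟩
      linarith
    · exact ⟨0, le_rfl, zero_le_one, fun h => absurd h hs⟩
  choose θ hθ0 hθ1 hθ using hθ
  set δ : V → ℝ := fun u => ∑ s ∈ S, if u ∈ P s then θ s * y u else 0 with hδ
  have hδ0 : ∀ u, 0 ≤ δ u := fun u => Finset.sum_nonneg fun s _ => by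
    split_ifs
    · exact mul_nonneg (hθ0 s) (hy0 u)
    · exact le_rfl
  have hδS : ∀ u ∈ S, δ u = 0 := fun u hu => Finset.sum_eq_zero fun s hs =>
    if_neg fun h => Finset.disjoint_left.1 (hPS s hs) h hu
  have hδy : ∀ u, δ u ≤ y u := by
    intro u
    by_cases h : ∃ s ∈ S, u ∈ P s
    · obtain ⟨s, hs, hus⟩ := h
      have : δ u = θ s * y u := by
        rw [hδ]
        dsimp only
        rw [Finset.sum_eq_single_of_mem s hs, if_pos hus]
        exact fun t ht hts => if_neg fun hut =>
          Finset.disjoint_left.1 (hPP t ht s hs hts) hut hus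
      rw [this]
      exact mul_le_of_le_one_left (hy0 u) (hθ1 s)
    · push Not at h
      rw [hδ]
      dsimp only
      rw [Finset.sum_eq_zero fun s hs => if_neg (h s hs)]
      exact hy0 u
  have hδU : ∀ U : Finset V, ∑ u ∈ U, δ u = ∑ s ∈ S, θ s * ∑ u ∈ U ∩ P s, y u := by
    intro U
    rw [hδ, Finset.sum_comm]
    refine Finset.sum_congr rfl fun s _ => ?_
    rw [Finset.mul_sum, ← Finset.sum_filter, Finset.filter_mem_eq_inter]
  have hw : ∀ u, (if u ∈ S then 1 else y u - δ u) =
      y u - δ u + if u ∈ S then 1 - y u else 0 := by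
    intro u
    split_ifs with h
    · rw [hδS u h]; ring
    · ring
  refine ⟨fun u => if u ∈ S then 1 else y u - δ u, ?_, ?_, ?_, ?_, ?_, ?_⟩
  · intro u
    dsimp only
    split_ifs
    · exact zero_le_one
    · exact sub_nonneg.2 (hδy u)
  · intro u
    dsimp only
    split_ifs
    · exact le_rfl
    · linarith [hδ0 u, hy1 u]
  · intro s hs
    exact if_pos hs
  · intro u hu
    dsimp only
    rw [if_neg hu]
    linarith [hδ0 u]
  · have h1 : ∑ u, δ u = ∑ s ∈ S, (1 - y s) := by
      rw [hδU]
      exact Finset.sum_congr rfl fun s hs => by rw [Finset.univ_inter, hθ s hs]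
    rw [Finset.sum_congr rfl fun u _ => hw u, Finset.sum_add_distrib, Finset.sum_sub_distrib,
      h1, ← Finset.sum_filter, Finset.filter_mem_eq_inter, Finset.univ_inter]
    ring
  · intro U
    set Q := S.filter (fun s => ∃ a ∈ U, a ∈ P s) with hQ
    have h1 : ∑ u ∈ U, δ u ≤ ∑ s ∈ Q, (1 - y s) := by
      rw [hδU, hQ, Finset.sum_filter]
      refine Finset.sum_le_sum fun s hs => ?_
      split_ifs with h
      · rw [← hθ s hs]
        exact mul_le_mul_of_nonneg_left (Finset.sum_le_sum_of_subset_of_nonneg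
          Finset.inter_subset_right fun u _ _ => hy0 u) (hθ0 s)
      · have : U ∩ P s = ∅ := by
          ext a
          simpa using fun ha hb => h ⟨a, ha, hb⟩
        simp [this]
    have h2 : ∑ u ∈ U, (y u - δ u) ≤ ∑ u ∈ U ∪ Q, (y u - δ u) :=
      Finset.sum_le_sum_of_subset_of_nonneg Finset.subset_union_left
        fun u _ _ => sub_nonneg.2 (hδy u)
    have h3 : ∑ s ∈ Q, (1 - y s) ≤ ∑ s ∈ U ∪ Q, if s ∈ S then 1 - y s else 0 := by
      rw [← Finset.sum_filter]
      refine Finset.sum_le_sum_of_subset_of_nonneg ?_ fun u _ _ => sub_nonneg.2 (hy1 u)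
      intro s hs
      exact Finset.mem_filter.2 ⟨Finset.mem_union_right U hs, (Finset.mem_filter.1 hs).1⟩
    rw [Finset.sum_congr rfl fun u _ => hw u, Finset.sum_add_distrib]
    rw [Finset.sum_sub_distrib] at h2
    linarith

lemma IsGraphicInstance.even_length_iff {V : Type*} [Fintype V] {G : SimpleGraph V}
    {Cs Fs : Finset V} (h : IsGraphicInstance G Cs Fs) {u v : V} (p : G.Walk u v) :
    Even p.length ↔ (u ∈ Fs ↔ v ∈ Fs) := by
  obtain ⟨hdisj, -, hadj⟩ := h
  rw [Finset.disjoint_left] at hdisj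
  induction p with
  | nil => simp
  | cons ha p ih =>
    rw [SimpleGraph.Walk.length_cons, Nat.even_add_one, ih]
    rcases hadj _ _ ha with ⟨h1, h2⟩ | ⟨h1, h2⟩
    · have := hdisj h1
      tauto
    · have := hdisj h2
      tauto

lemma IsGraphicInstance.exists_link {V : Type*} [Fintype V] {G : SimpleGraph V}
    {Cs Fs : Finset V} (hinst : IsGraphicInstance G Cs Fs) {S : Finset V} (hSF : S ⊆ Fs)
    (hconn : G.Connected) (hcov : ∀ v : V, ∃ s ∈ S, G.edist v s ≤ 5) {T : Finset V}
    (hTS : T ⊆ S) (hT : T.Nonempty) (hne : T ≠ S) :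
    ∃ t ∈ T, ∃ s ∈ S, s ∉ T ∧ G.edist s t ≤ 10 := by
  have hclose : ∃ t ∈ T, ∃ s ∈ S, s ∉ T ∧ G.edist s t ≤ 11 := by
    obtain ⟨t₀, ht₀⟩ := hT
    obtain ⟨s₀, hs₀, hs₀T⟩ := Finset.exists_of_ssubset (hTS.ssubset_of_ne hne)
    obtain ⟨q⟩ := hconn.preconnected t₀ s₀
    by_cases hs : ∃ t ∈ T, G.edist s₀ t ≤ 5
    · obtain ⟨t, ht, hd⟩ := hs
      exact ⟨t, ht, s₀, hs₀, hs₀T, hd.trans (by norm_num)⟩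
    obtain ⟨e, -, ⟨t, ht, hd1⟩, he2⟩ := q.exists_boundary_dart
      {v | ∃ t ∈ T, G.edist v t ≤ 5} ⟨t₀, ht₀, by simp⟩ hs
    obtain ⟨s, hsS, hd2⟩ := hcov e.snd
    refine ⟨t, ht, s, hsS, fun h => he2 ⟨s, h, hd2⟩, ?_⟩
    have h1 : G.edist e.snd e.fst = 1 := SimpleGraph.edist_eq_one_iff_adj.2 e.adj.symm
    calc G.edist s t ≤ G.edist s e.snd + (G.edist e.snd e.fst + G.edist e.fst t) :=
          SimpleGraph.edist_triangle.trans (add_le_add_right SimpleGraph.edist_triangle _)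
      _ ≤ 5 + (1 + 5) := by
          rw [h1, SimpleGraph.edist_comm (u := s)]
          gcongr
      _ = 11 := by norm_num
  obtain ⟨t, ht, s, hs, hsT, hd⟩ := hclose
  obtain ⟨q, hq⟩ := SimpleGraph.exists_walk_of_edist_ne_top
    (ne_top_of_le_ne_top (by decide) hd)
  have heven := (hinst.even_length_iff q).2 (by simp [hSF hs, hSF (hTS ht)])
  rw [← hq] at hd
  have h11 : q.length ≤ 11 := by exact_mod_cast hd
  refine ⟨t, ht, s, hs, hsT, ?_⟩
  rw [← hq]
  have h10 : q.length ≤ 10 := by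
    obtain ⟨m, hm⟩ := heven
    omega
  exact_mod_cast h10

/-- Under the assumptions of the rounding lemma, if the capacities are
uniform (constant on `ℱ`), then the instance admits a distance-23 solution. -/
theorem rounding_23_uniform {V : Type*} [Fintype V] [DecidableEq V]
    (G : SimpleGraph V) (Cs Fs : Finset V) (L : V → ℕ) (k p : ℕ)
    (hinst : IsGraphicInstance G Cs Fs)
    (huniform : ∃ c : ℕ, ∀ u ∈ Fs, L u = c)
    (S : Finset V) (hSF : S ⊆ Fs)
    (hconn : G.Connected)
    (hsep : ∀ u ∈ S, ∀ u' ∈ S, u ≠ u' → 6 ≤ G.edist u u')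
    (hcov : ∀ v : V, ∃ s ∈ S, G.edist v s ≤ 5)
    (hLP : LPFeasible G Cs Fs L k p S) :
    ∃ C F φ, IsSolution G Cs Fs L k p 23 C F φ := by
  obtain ⟨c, hc⟩ := huniform
  obtain ⟨x, y, hy, hx, hk, hp, hxy, hxL, hxv, hyS, hxadj⟩ := hLP
  have hSne : S.Nonempty := by
    obtain ⟨v⟩ := hconn.nonempty
    obtain ⟨s, hs, -⟩ := hcov v
    exact ⟨s, hs⟩
  have hclose : ∀ s ∈ S, ∀ t ∈ S, G.edist s t ≤ 4 → s = t := by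
    intro s hs t ht hst
    by_contra hne
    exact absurd ((hsep s hs t ht hne).trans hst) (by decide)
  have htri : ∀ {a b d : V} {m n : ℕ∞}, G.edist a b ≤ m → G.edist b d ≤ n →
      G.edist a d ≤ m + n := fun h1 h2 =>
    SimpleGraph.edist_triangle.trans (add_le_add h1 h2)
  set z : V → ℝ := fun u => if u ∈ Fs then y u else 0 with hz
  have hz0 : ∀ u, 0 ≤ z u := fun u => by
    rw [hz]; dsimp only; split_ifs
    exacts [(hy u).1, le_rfl]
  have hz1 : ∀ u, z u ≤ 1 := fun u => by
    rw [hz]; dsimp only; split_ifs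
    exacts [(hy u).2, zero_le_one]
  have hzF : ∀ u ∈ Fs, z u = y u := fun u hu => if_pos hu
  have hzk : ∑ u, z u = k := by
    rw [← hk, hz, ← Finset.sum_filter, Finset.filter_mem_eq_inter, Finset.univ_inter]
  obtain ⟨w, hw0, hw1, hwS, hwz, hwsum, hwU⟩ := exists_concentrated_weight S
    (fun s => Fs.filter fun u => G.edist u s ≤ 2 ∧ u ≠ s) z hz0 hz1
    (by
      intro s hs
      rw [Finset.disjoint_left]
      intro u hu huS
      obtain ⟨-, hd, hne⟩ := Finset.mem_filter.1 hu
      exact hne (hclose u huS s hs (hd.trans (by decide))))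
    (by
      intro s hs t ht hst
      rw [Finset.disjoint_left]
      intro u hus hut
      obtain ⟨-, hd1, -⟩ := Finset.mem_filter.1 hus
      obtain ⟨-, hd2, -⟩ := Finset.mem_filter.1 hut
      rw [SimpleGraph.edist_comm] at hd1
      exact hst (hclose s hs t ht ((htri hd1 hd2).trans (by norm_num))))
    (by
      intro s hs
      have hs2 : s ∈ Fs.filter fun u => G.edist u s ≤ 2 := by simp [hSF hs]
      refine (hyS s hs).trans (le_of_eq ?_)
      rw [← Finset.add_sum_erase _ _ hs2, hzF s (hSF hs)]
      congr 1
      refine Finset.sum_congr ?_ fun u hu => (hzF u (Finset.mem_filter.1 hu).1).symm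
      ext u
      simp only [Finset.mem_erase, Finset.mem_filter]
      tauto)
  have hwF : ∀ u, 0 < w u → u ∈ Fs := by
    intro u hu
    by_contra huF
    have h1 := hwz u fun h => huF (hSF h)
    have h2 : z u = 0 := if_neg huF
    linarith
  obtain ⟨F, hFpos, hFcard, hFU⟩ := admitsRounding_of_linked (N := fun u v => G.edist u v ≤ 10)
    (R := fun u v => G.edist u v ≤ 20) hSne (by simp)
    (by
      intro s u v hu hv
      rw [SimpleGraph.edist_comm] at hv
      have hu' : G.edist u s ≤ 10 := by
        rcases hu with rfl | hu
        · simp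
        · exact hu
      exact (htri hu' hv).trans (by norm_num))
    (fun T hTS hT hne => hinst.exists_link hSF hconn hcov hTS hT hne)
    w hw0 hw1 hwS (fun u _ _ => by
      obtain ⟨s, hs, hd⟩ := hcov u
      exact ⟨s, hs, hd.trans (by decide)⟩) ⟨k, hwsum.trans hzk⟩
  have hFFs : F ⊆ Fs := fun u hu => hwF u (hFpos u hu)
  have hFk : F.card = k := by
    rw [hwsum, hzk] at hFcard
    exact_mod_cast hFcard
  obtain ⟨C, hC, hCp, φ, hφ, hφc⟩ := exists_capacitated_assignment Cs F
    (fun v u => G.edist v u ≤ 23) c p (by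
      intro A hA
      set U := Fs.filter fun u => ∃ v ∈ A, G.Adj v u with hU
      have hUF : U ⊆ Fs := Finset.filter_subset _ _
      have h1 : ∑ v ∈ A, ∑ u ∈ Fs, x u v ≤ c * ∑ u ∈ U, z u := by
        rw [Finset.sum_comm, Finset.mul_sum, ← Finset.sum_subset hUF]
        · refine Finset.sum_le_sum fun u hu => ?_
          rw [hzF u (hUF hu), ← hc u (hUF hu)]
          exact (Finset.sum_le_sum_of_subset_of_nonneg hA fun v _ _ => (hx u v).1).trans
            (hxL u (hUF hu))
        · intro u huF huU
          refine Finset.sum_eq_zero fun v hv => hxadj u huF v (hA hv) fun h => huU ?_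
          exact Finset.mem_filter.2 ⟨huF, v, hv, h⟩
      have h2 : ∑ u ∈ U, z u ≤
          ((F.filter fun u => ∃ v ∈ A, G.edist v u ≤ 23).card : ℝ) := by
        refine ((hwU U).trans (hFU _)).trans ?_
        refine Nat.cast_le.2 (Finset.card_le_card fun u hu => ?_)
        simp only [Finset.mem_filter] at hu
        obtain ⟨huF, b, hb, hbu⟩ := hu
        refine Finset.mem_filter.2 ⟨huF, ?_⟩
        have hab : ∃ a ∈ U, G.edist a b ≤ 2 := by
          rcases Finset.mem_union.1 hb with hb | hb
          · exact ⟨b, hb, by simp⟩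
          · obtain ⟨-, a, ha, -, hab, -⟩ := Finset.mem_filter.1 hb
            exact ⟨a, ha, hab⟩
        obtain ⟨a, ha, hab⟩ := hab
        obtain ⟨-, v, hv, hva⟩ := Finset.mem_filter.1 ha
        exact ⟨v, hv, (htri (SimpleGraph.edist_eq_one_iff_adj.2 hva).le
          (htri hab hbu)).trans (by norm_num)⟩
      have h3 : (p : ℝ) ≤ ∑ v ∈ A, ∑ u ∈ Fs, x u v + (Cs.card - A.card) := by
        rw [← hp, Finset.sum_comm, ← Finset.sum_sdiff hA]
        have h4 : ∑ v ∈ Cs \ A, ∑ u ∈ Fs, x u v ≤ ((Cs \ A).card : ℝ) := by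
          simpa using Finset.sum_le_card_nsmul (Cs \ A) (fun v => ∑ u ∈ Fs, x u v) 1
            fun v hv => hxv v (Finset.mem_sdiff.1 hv).1
        have h5 : ((Cs \ A).card : ℝ) + A.card = Cs.card := by
          exact_mod_cast Finset.card_sdiff_add_card_eq_card hA
        linarith
      have h6 := mul_le_mul_of_nonneg_left h2 (Nat.cast_nonneg (α := ℝ) c)
      have h7 : (p : ℝ) + A.card ≤
          c * ((F.filter fun u => ∃ v ∈ A, G.edist v u ≤ 23).card : ℝ) + Cs.card := by
        linarith
      exact_mod_cast h7)
  exact ⟨C, F, φ, hC, hFFs, hCp, hFk, fun v hv => (hφ v hv).1,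
    fun u hu => (hφc u).trans_eq (hc u (hFFs hu)).symm, fun v hv => (hφ v hv).2⟩
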